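/- arXiv:1403.5691 — 2 statements merged into one kernel-verified Lean document; each statement's English description precedes it below -/
import Mathlib

section
/- Let ż, ḣ, ż', ḣ' ∈ ℂ, let N be an R_ż-module and N' an R_{ż'}-module, and assume that the 𝔞-modules N_{ż,ḣ} and N'_{ż',ḣ'} are simple. Then N_{ż,ḣ} ≅ N'_{ż',ḣ'} as 𝔞-modules if and only if ż = ż', i := ḣ − ḣ' ∈ ℤ, and N' is isomorphic, as an R_ż-module, to the twist N^{τ_{i,ż}} of N by the automorphism τ_{i,ż}. -/
noncomputable section

/-- The ageing Lie algebra `𝔞`: a complex Lie algebra with basis `{E, H, P, Q, Z}` and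
nonzero brackets `[H,E] = 2E`, `[H,P] = P`, `[H,Q] = -Q`, `[E,Q] = P`, `[P,Q] = Z`,
with `Z` central and all other brackets of basis elements zero. -/
structure IsAgeingBasis (𝔞 : Type*) [LieRing 𝔞] [LieAlgebra ℂ 𝔞]
    (E H P Q Z : 𝔞) : Prop where
  indep : LinearIndependent ℂ ![E, H, P, Q, Z]
  span : Submodule.span ℂ {E, H, P, Q, Z} = ⊤
  lie_he : ⁅H, E⁆ = (2 : ℂ) • E
  lie_hp : ⁅H, P⁆ = P
  lie_hq : ⁅H, Q⁆ = -Q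
  lie_eq : ⁅E, Q⁆ = P
  lie_pq : ⁅P, Q⁆ = Z
  lie_ep : ⁅E, P⁆ = 0
  lie_ez : ⁅E, Z⁆ = 0
  lie_hz : ⁅H, Z⁆ = 0
  lie_pz : ⁅P, Z⁆ = 0
  lie_qz : ⁅Q, Z⁆ = 0
/-- The operator `d/dt` on `ℂ[t]`. -/
def Dt : Module.End ℂ (Polynomial ℂ) := Polynomial.derivative

/-- The operator of multiplication by `t` on `ℂ[t]`. -/
def Tm : Module.End ℂ (Polynomial ℂ) := LinearMap.mulLeft ℂ Polynomial.X

/-- The first Weyl algebra, realized as the subalgebra of endomorphisms of `ℂ[t]`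
generated by `d/dt` and multiplication by `t`. -/
def WeylA : Subalgebra ℂ (Module.End ℂ (Polynomial ℂ)) := Algebra.adjoin ℂ {Dt, Tm}

/-- `R₀`: the subalgebra of the Weyl algebra generated by `t` and `t²(d/dt)`. -/
def R0 : Subalgebra ℂ (Module.End ℂ (Polynomial ℂ)) := Algebra.adjoin ℂ {Tm, Tm ^ 2 * Dt}

/-- `R₁`: the subalgebra of the Weyl algebra generated by `t` and `t(d/dt)`. -/
def R1 : Subalgebra ℂ (Module.End ℂ (Polynomial ℂ)) := Algebra.adjoin ℂ {Tm, Tm * Dt}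

/-- `R_zc`, which is `R₀` for `zc = 0` and `R₁` otherwise. -/
def Rz (zc : ℂ) : Subalgebra ℂ (Module.End ℂ (Polynomial ℂ)) := if zc = 0 then R0 else R1

/-- The element `t` of `R_zc`. -/
def tR (zc : ℂ) : Rz zc :=
  ⟨Tm, by unfold Rz; split <;> exact Algebra.subset_adjoin (by simp)⟩

/-- The second canonical generator of `R_zc`: `t²(d/dt)` if `zc = 0` and `t(d/dt)` otherwise. -/
def dR (zc : ℂ) : Rz zc :=
  ⟨if zc = 0 then Tm ^ 2 * Dt else Tm * Dt, by
    unfold Rz; split_ifs <;> exact Algebra.subset_adjoin (by simp)⟩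

/-- The element of `R_zc` by which `p` acts from weight `ḣ - i` (up to the shift in the
Laurent variable): `t` if `zc = 0`, and `2zc·t(d/dt) + (i-1)zc` if `zc ≠ 0`. -/
def pOp (zc : ℂ) (i : ℤ) : Rz zc :=
  if zc = 0 then tR zc else (2 * zc) • dR zc + (((i : ℂ) - 1) * zc) • 1

/-- The element of `R_zc` by which `e` acts from weight `ḣ - i` (up to the shift in the
Laurent variable): `t²(d/dt) + (i-2)t` if `zc = 0`, and
`t + (2i-3)zc·t(d/dt) + 2zc·(t(d/dt))² + ((i-1)(i-2)/2)zc` if `zc ≠ 0`. -/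
def eOp (zc : ℂ) (i : ℤ) : Rz zc :=
  if zc = 0 then dR zc + ((i : ℂ) - 2) • tR zc
  else tR zc + ((2 * (i : ℂ) - 3) * zc) • dR zc + (2 * zc) • (dR zc) ^ 2 +
    (((i : ℂ) - 1) * ((i : ℂ) - 2) / 2 * zc) • 1


/-- A linear map commuting with the elements of an ageing basis commutes with the whole
ageing algebra. -/
lemma IsAgeingBasis.map_lie {𝔞 : Type*} [LieRing 𝔞] [LieAlgebra ℂ 𝔞]
    {E H P Q Z : 𝔞} (hA : IsAgeingBasis 𝔞 E H P Q Z)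
    {M M' : Type*} [AddCommGroup M] [Module ℂ M] [AddCommGroup M'] [Module ℂ M']
    [LieRingModule 𝔞 M] [LieModule ℂ 𝔞 M] [LieRingModule 𝔞 M'] [LieModule ℂ 𝔞 M']
    (f : M →ₗ[ℂ] M')
    (hE : ∀ m, f ⁅E, m⁆ = ⁅E, f m⁆) (hH : ∀ m, f ⁅H, m⁆ = ⁅H, f m⁆)
    (hP : ∀ m, f ⁅P, m⁆ = ⁅P, f m⁆) (hQ : ∀ m, f ⁅Q, m⁆ = ⁅Q, f m⁆)
    (hZ : ∀ m, f ⁅Z, m⁆ = ⁅Z, f m⁆) (x : 𝔞) (m : M) : f ⁅x, m⁆ = ⁅x, f m⁆ := by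
  have hx : x ∈ Submodule.span ℂ {E, H, P, Q, Z} := by rw [hA.span]; trivial
  induction hx using Submodule.span_induction with
  | mem y hy =>
    simp only [Set.mem_insert_iff, Set.mem_singleton_iff] at hy
    rcases hy with rfl | rfl | rfl | rfl | rfl
    exacts [hE m, hH m, hP m, hQ m, hZ m]
  | zero => simp
  | add y z _ _ hy hz => simp [hy, hz]
  | smul c y _ hy => simp [hy]

/-- A linear map between spaces of Laurent polynomials commutes with a Lie algebra element
as soon as it does so on monomials. -/
lemma map_lie_of_single {𝔞 : Type*} [LieRing 𝔞]
    {M M' : Type*} [AddCommGroup M] [Module ℂ M]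
    [AddCommGroup M'] [Module ℂ M'] [LieRingModule 𝔞 (ℤ →₀ M)] [LieRingModule 𝔞 M']
    (f : (ℤ →₀ M) →ₗ[ℂ] M') (x : 𝔞)
    (h : ∀ (k : ℤ) (v : M), f ⁅x, Finsupp.single k v⁆ = ⁅x, f (Finsupp.single k v)⁆)
    (m : ℤ →₀ M) : f ⁅x, m⁆ = ⁅x, f m⁆ := by
  induction m using Finsupp.induction_linear with
  | zero => simp
  | add a b ha hb => simp [ha, hb]
  | single k v => exact h k v

/-- An element acting diagonally on monomials acts diagonally on coefficients. -/
lemma lie_apply_of_single {𝔞 : Type*} [LieRing 𝔞]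
    {M : Type*} [AddCommGroup M] [Module ℂ M]
    [LieRingModule 𝔞 (ℤ →₀ M)] {H : 𝔞} {c : ℤ → ℂ}
    (h : ∀ (k : ℤ) (v : M), ⁅H, Finsupp.single k v⁆ = c k • Finsupp.single k v)
    (m : ℤ →₀ M) (k : ℤ) : ⁅H, m⁆ k = c k • m k := by
  induction m using Finsupp.induction_linear with
  | zero => simp
  | add a b ha hb => simp [ha, hb]
  | single j v =>
    rw [h, Finsupp.smul_apply]
    by_cases hjk : j = k
    · rw [hjk]
    · simp [Finsupp.single_eq_of_ne' hjk]

lemma pOp_zero_smul {zc : ℂ} {N : Type*} [AddCommGroup N] [Module (Rz zc) N]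
    (hz : zc = 0) (k : ℤ) (v : N) : pOp zc k • v = tR zc • v := by
  rw [pOp, if_pos hz]

lemma eOp_zero_smul {zc : ℂ}
    {N : Type*} [AddCommGroup N] [Module ℂ N] [Module (Rz zc) N] [IsScalarTower ℂ (Rz zc) N]
    (hz : zc = 0) (k : ℤ) (v : N) :
    eOp zc k • v = dR zc • v + ((k : ℂ) - 2) • tR zc • v := by
  rw [eOp, if_pos hz, add_smul, smul_assoc]

lemma pOp_ne_zero_smul {zc : ℂ}
    {N : Type*} [AddCommGroup N] [Module ℂ N] [Module (Rz zc) N] [IsScalarTower ℂ (Rz zc) N]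
    (hz : zc ≠ 0) (k : ℤ) (v : N) :
    pOp zc k • v = (2 * zc) • dR zc • v + (((k : ℂ) - 1) * zc) • v := by
  rw [pOp, if_neg hz, add_smul, smul_assoc, smul_assoc, one_smul]

lemma eOp_ne_zero_smul {zc : ℂ}
    {N : Type*} [AddCommGroup N] [Module ℂ N] [Module (Rz zc) N] [IsScalarTower ℂ (Rz zc) N]
    (hz : zc ≠ 0) (k : ℤ) (v : N) :
    eOp zc k • v = tR zc • v + ((2 * (k : ℂ) - 3) * zc) • dR zc • v +
      (2 * zc) • dR zc • dR zc • v + (((k : ℂ) - 1) * ((k : ℂ) - 2) / 2 * zc) • v := by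
  rw [eOp, if_neg hz, add_smul, add_smul, add_smul, smul_assoc, smul_assoc, smul_assoc,
    one_smul, pow_two, mul_smul (dR zc) (dR zc)]

/-- A linear map intertwines the operators `pOp` and `eOp` with indices shifted by `i` if
and only if it is a homomorphism to the twist by `τ_{i,zc}`. -/
lemma intertwines_shift_iff {zc : ℂ}
    {N : Type*} [AddCommGroup N] [Module ℂ N] [Module (Rz zc) N] [IsScalarTower ℂ (Rz zc) N]
    {N' : Type*} [AddCommGroup N'] [Module ℂ N'] [Module (Rz zc) N'] [IsScalarTower ℂ (Rz zc) N']
    (i : ℤ) (ψ : N' →ₗ[ℂ] N) :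
    ((∀ (k : ℤ) (w : N'), ψ (pOp zc k • w) = pOp zc (k + i) • ψ w) ∧
      (∀ (k : ℤ) (w : N'), ψ (eOp zc k • w) = eOp zc (k + i) • ψ w)) ↔
    (∀ w : N', ψ (tR zc • w) = tR zc • ψ w) ∧
      (∀ w : N', ψ (dR zc • w) =
        (dR zc + (if zc = 0 then (i : ℂ) • tR zc
          else algebraMap ℂ (Rz zc) ((i : ℂ) / 2))) • ψ w) := by
  by_cases hz : zc = 0
  · simp only [if_pos hz, pOp_zero_smul hz, eOp_zero_smul hz, add_smul, smul_assoc, map_add,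
      map_smul]
    constructor
    · rintro ⟨hp, he⟩
      refine ⟨hp 0, fun w ↦ ?_⟩
      have h := he 0 w
      rw [hp 0 w] at h
      rw [eq_sub_of_add_eq h]
      push_cast
      generalize tR zc • ψ w = a, dR zc • ψ w = b
      module
    · rintro ⟨ht, hd⟩
      refine ⟨fun _ ↦ ht, fun k w ↦ ?_⟩
      rw [ht, hd]
      push_cast
      generalize tR zc • ψ w = a, dR zc • ψ w = b
      module
  · have htwist (v : N) : (dR zc + algebraMap ℂ (Rz zc) ((i : ℂ) / 2)) • v =
        dR zc • v + ((i : ℂ) / 2) • v := by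
      rw [add_smul, algebraMap_smul]
    have hdt (v : N) (c : ℂ) : dR zc • c • v = c • dR zc • v := by
      rw [← algebraMap_smul (Rz zc) c v, ← algebraMap_smul (Rz zc) c (dR zc • v), smul_smul,
        smul_smul, Algebra.commutes]
    simp only [if_neg hz, htwist, pOp_ne_zero_smul hz, eOp_ne_zero_smul hz, map_add, map_smul]
    constructor
    · rintro ⟨hp, he⟩
      have hd (w : N') : ψ (dR zc • w) = dR zc • ψ w + ((i : ℂ) / 2) • ψ w := by
        have h := hp 0 w
        have h2 : (2 * zc) • ψ (dR zc • w) =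
            (2 * zc) • (dR zc • ψ w + ((i : ℂ) / 2) • ψ w) := by
          rw [eq_sub_of_add_eq h]
          push_cast
          generalize dR zc • ψ w = b
          module
        exact smul_right_injective N (mul_ne_zero two_ne_zero hz) h2
      refine ⟨fun w ↦ ?_, hd⟩
      have h := he 0 w
      simp only [hd, smul_add, hdt, add_assoc] at h
      rw [eq_sub_of_add_eq h]
      push_cast
      generalize dR zc • dR zc • ψ w = c
      generalize tR zc • ψ w = a, dR zc • ψ w = b
      module
    · rintro ⟨ht, hd⟩
      refine ⟨fun k w ↦ ?_, fun k w ↦ ?_⟩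
      · rw [hd]
        push_cast
        generalize dR zc • ψ w = b
        module
      · simp only [ht, hd, smul_add, hdt]
        push_cast
        generalize dR zc • dR zc • ψ w = c
        generalize tR zc • ψ w = a, dR zc • ψ w = b
        module

/-- A linear map between Laurent polynomial spaces which preserves the diagonal action of `H`
and commutes with multiplication by `x` is a shift composed with a map of coefficients. -/
lemma exists_eq_single_shift {𝔞 : Type*} [LieRing 𝔞]
    {M M' : Type*} [AddCommGroup M] [Module ℂ M]
    [AddCommGroup M'] [Module ℂ M'] [LieRingModule 𝔞 (ℤ →₀ M)]
    [LieRingModule 𝔞 (ℤ →₀ M')] {H Q : 𝔞} {c c' : ℂ} {i : ℤ} (hi : c - c' = i)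
    (hH : ∀ (k : ℤ) (v : M), ⁅H, Finsupp.single k v⁆ = (c - (k : ℂ)) • Finsupp.single k v)
    (hQ : ∀ (k : ℤ) (v : M), ⁅Q, Finsupp.single k v⁆ = Finsupp.single (k + 1) v)
    (hH' : ∀ (k : ℤ) (v : M'), ⁅H, Finsupp.single k v⁆ = (c' - (k : ℂ)) • Finsupp.single k v)
    (hQ' : ∀ (k : ℤ) (v : M'), ⁅Q, Finsupp.single k v⁆ = Finsupp.single (k + 1) v)
    (φ : (ℤ →₀ M') →ₗ[ℂ] (ℤ →₀ M)) (hφ : ∀ (x : 𝔞) (m : ℤ →₀ M'), φ ⁅x, m⁆ = ⁅x, φ m⁆) :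
    ∃ ψ : M' →ₗ[ℂ] M, ∀ (k : ℤ) (w : M'),
      φ (Finsupp.single k w) = Finsupp.single (k + i) (ψ w) := by
  have hsingle (k : ℤ) (w : M') : φ (Finsupp.single k w) =
      Finsupp.single (k + i) (φ (Finsupp.single k w) (k + i)) := by
    ext j
    by_cases hj : k + i = j
    · rw [hj, Finsupp.single_eq_same]
    · rw [Finsupp.single_eq_of_ne' hj]
      have h := lie_apply_of_single hH (φ (Finsupp.single k w)) j
      rw [← hφ, hH', map_smul, Finsupp.smul_apply, ← sub_eq_zero, ← sub_smul] at h
      refine (smul_eq_zero.mp h).resolve_left fun h0 ↦ hj ?_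
      have : (k : ℂ) + i = j := by rw [← hi]; linear_combination -h0
      exact_mod_cast this
  have hstep (k : ℤ) (w : M') : φ (Finsupp.single (k + 1) w) (k + 1 + i) =
      φ (Finsupp.single k w) (k + i) := by
    rw [← hQ', hφ, hsingle, hQ, add_right_comm k i 1, Finsupp.single_eq_same,
      Finsupp.single_eq_same]
  refine ⟨Finsupp.lapply i ∘ₗ φ ∘ₗ Finsupp.lsingle 0, fun k w ↦ ?_⟩
  rw [hsingle]
  congr 1
  simp only [LinearMap.comp_apply, Finsupp.lapply_apply, Finsupp.lsingle_apply]
  induction k using Int.induction_on with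
  | zero => rw [zero_add]
  | succ k ih => rw [hstep, ih]
  | pred k ih => rw [← ih, ← hstep, sub_add_cancel]

/-- Let `zc, hc, zc', hc' ∈ ℂ`, let `N` be an `R_zc`-module and `N'`
an `R_{zc'}`-module, and assume the `𝔞`-modules `N_{zc,hc}` and `N'_{zc',hc'}` (realized
on `ℤ →₀ N` and `ℤ →₀ N'`, with `Finsupp.single i v` corresponding to `v ⊗ xⁱ`) are
simple.  Then `N_{zc,hc} ≅ N'_{zc',hc'}` as `𝔞`-modules if and only if `zc = zc'`,
`i := hc - hc' ∈ ℤ`, and `N'` is isomorphic, as an `R_zc`-module, to the twist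
`N^{τ_{i,zc}}` of `N` by the automorphism `τ_{i,zc}` (the latter condition is expressed
below via a linear equivalence `ψ : N' ≃ N` intertwining the actions through the images
`τ_{i,zc}(t) = t` and `τ_{i,zc}(t²(d/dt)) = t²(d/dt) + i·t` for `zc = 0`, respectively
`τ_{i,zc}(t(d/dt)) = t(d/dt) + i/2` for `zc ≠ 0`, on the generators of `R_zc`). -/
theorem Nzh_iso_iff
    {𝔞 : Type*} [LieRing 𝔞] [LieAlgebra ℂ 𝔞] {E H P Q Z : 𝔞}
    (hA : IsAgeingBasis 𝔞 E H P Q Z) (zc hc zc' hc' : ℂ)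
    (N : Type*) [AddCommGroup N] [Module ℂ N]
    [Module (Rz zc) N] [IsScalarTower ℂ (Rz zc) N]
    (N' : Type*) [AddCommGroup N'] [Module ℂ N']
    [Module (Rz zc') N'] [IsScalarTower ℂ (Rz zc') N']
    [LieRingModule 𝔞 (ℤ →₀ N)] [LieModule ℂ 𝔞 (ℤ →₀ N)]
    [LieRingModule 𝔞 (ℤ →₀ N')] [LieModule ℂ 𝔞 (ℤ →₀ N')]
    (act_h : ∀ (i : ℤ) (v : N),
      ⁅H, Finsupp.single i v⁆ = (hc - (i : ℂ)) • Finsupp.single i v)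
    (act_z : ∀ (i : ℤ) (v : N),
      ⁅Z, Finsupp.single i v⁆ = zc • Finsupp.single i v)
    (act_q : ∀ (i : ℤ) (v : N),
      ⁅Q, Finsupp.single i v⁆ = Finsupp.single (i + 1) v)
    (act_p : ∀ (i : ℤ) (v : N),
      ⁅P, Finsupp.single i v⁆ = Finsupp.single (i - 1) (pOp zc i • v))
    (act_e : ∀ (i : ℤ) (v : N),
      ⁅E, Finsupp.single i v⁆ = Finsupp.single (i - 2) (eOp zc i • v))
    (act_h' : ∀ (i : ℤ) (v : N'),
      ⁅H, Finsupp.single i v⁆ = (hc' - (i : ℂ)) • Finsupp.single i v)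
    (act_z' : ∀ (i : ℤ) (v : N'),
      ⁅Z, Finsupp.single i v⁆ = zc' • Finsupp.single i v)
    (act_q' : ∀ (i : ℤ) (v : N'),
      ⁅Q, Finsupp.single i v⁆ = Finsupp.single (i + 1) v)
    (act_p' : ∀ (i : ℤ) (v : N'),
      ⁅P, Finsupp.single i v⁆ = Finsupp.single (i - 1) (pOp zc' i • v))
    (act_e' : ∀ (i : ℤ) (v : N'),
      ⁅E, Finsupp.single i v⁆ = Finsupp.single (i - 2) (eOp zc' i • v))
    (hsimple : LieModule.IsIrreducible ℂ 𝔞 (ℤ →₀ N))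
    (hsimple' : LieModule.IsIrreducible ℂ 𝔞 (ℤ →₀ N')) :
    Nonempty ((ℤ →₀ N) ≃ₗ⁅ℂ,𝔞⁆ (ℤ →₀ N')) ↔
      (zc = zc' ∧ ∃ i : ℤ, hc - hc' = (i : ℂ) ∧
        ∃ ψ : N' ≃ₗ[ℂ] N,
          (∀ w : N', ψ (tR zc' • w) = tR zc • ψ w) ∧
          (∀ w : N', ψ (dR zc' • w) =
            (dR zc + (if zc = 0 then (i : ℂ) • tR zc
              else algebraMap ℂ (Rz zc) ((i : ℂ) / 2))) • ψ w)) := by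
  constructor
  · rintro ⟨φ⟩
    have hφ (x : 𝔞) (m : ℤ →₀ N) : φ ⁅x, m⁆ = ⁅x, φ m⁆ := φ.map_lie x m
    have : Nontrivial (ℤ →₀ N) := (LieSubmodule.nontrivial_iff ℂ 𝔞 (ℤ →₀ N)).mp inferInstance
    have : Nontrivial N := by
      by_contra hN
      rw [not_nontrivial_iff_subsingleton] at hN
      exact not_subsingleton (ℤ →₀ N) inferInstance
    obtain ⟨v, hv⟩ := exists_ne (0 : N)
    have hv0 : φ (Finsupp.single 0 v) ≠ 0 := fun h ↦
      hv (Finsupp.single_eq_zero.mp (φ.injective (h.trans (map_zero φ).symm)))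
    obtain ⟨k, hk⟩ := Finsupp.ne_iff.mp hv0
    rw [Finsupp.zero_apply] at hk
    have hzz : zc = zc' := by
      have h := lie_apply_of_single (c := fun _ ↦ zc') act_z' (φ (Finsupp.single 0 v)) k
      rw [← hφ, act_z, map_smul, Finsupp.smul_apply] at h
      exact smul_left_injective ℂ hk h
    have hi : hc - hc' = ((-k : ℤ) : ℂ) := by
      have h := lie_apply_of_single act_h' (φ (Finsupp.single 0 v)) k
      rw [← hφ, act_h, map_smul, Finsupp.smul_apply] at h
      have := smul_left_injective ℂ hk h
      push_cast at this ⊢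
      linear_combination this
    subst hzz
    refine ⟨rfl, -k, hi, ?_⟩
    obtain ⟨ψ, hψ⟩ := exists_eq_single_shift hi act_h act_q act_h' act_q'
      (φ.symm : (ℤ →₀ N') →ₗ[ℂ] (ℤ →₀ N)) fun x m ↦ φ.symm.map_lie x m
    have hψ_inj : Function.Injective ψ := fun a b hab ↦ by
      refine Finsupp.single_injective 0 (φ.symm.injective ?_)
      exact (hψ 0 a).trans ((congrArg _ hab).trans (hψ 0 b).symm)
    obtain ⟨g, hg⟩ := exists_eq_single_shift (i := k) (c := hc') (c' := hc)
      (by push_cast at hi; linear_combination -hi) act_h' act_q' act_h act_q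
      (φ : (ℤ →₀ N) →ₗ[ℂ] (ℤ →₀ N')) hφ
    have hψ_surj : Function.Surjective ψ := fun a ↦ by
      refine ⟨g a, Finsupp.single_injective (0 + k + -k) ?_⟩
      rw [← hψ, ← hg]
      refine (φ.symm_apply_apply _).trans ?_
      rw [zero_add, add_neg_cancel]
    refine ⟨LinearEquiv.ofBijective ψ ⟨hψ_inj, hψ_surj⟩,
      (intertwines_shift_iff (-k) ψ).mp ⟨fun j w ↦ ?_, fun j w ↦ ?_⟩⟩
    · have h : φ.symm ⁅P, Finsupp.single j w⁆ = ⁅P, φ.symm (Finsupp.single j w)⁆ :=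
        φ.symm.map_lie _ _
      rw [act_p'] at h
      replace h := (hψ _ _).symm.trans (h.trans (congrArg (⁅P, ·⁆) (hψ j w)))
      simp only [act_p, sub_add_eq_add_sub] at h
      exact Finsupp.single_injective _ h
    · have h : φ.symm ⁅E, Finsupp.single j w⁆ = ⁅E, φ.symm (Finsupp.single j w)⁆ :=
        φ.symm.map_lie _ _
      rw [act_e'] at h
      replace h := (hψ _ _).symm.trans (h.trans (congrArg (⁅E, ·⁆) (hψ j w)))
      simp only [act_e, sub_add_eq_add_sub] at h
      exact Finsupp.single_injective _ h
  · rintro ⟨rfl, i, hi, ψ, hψ⟩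
    obtain ⟨hp, he⟩ := (intertwines_shift_iff i (ψ : N' →ₗ[ℂ] N)).mpr hψ
    let f : (ℤ →₀ N') ≃ₗ[ℂ] (ℤ →₀ N) := Finsupp.lcongr (Equiv.addRight i) ψ
    have hf (k : ℤ) (w : N') : f (Finsupp.single k w) = Finsupp.single (k + i) (ψ w) :=
      Finsupp.lcongr_single _ _ _ _
    have hlie := hA.map_lie (f : (ℤ →₀ N') →ₗ[ℂ] (ℤ →₀ N))
      (map_lie_of_single _ E fun k w ↦ ?_) (map_lie_of_single _ H fun k w ↦ ?_)
      (map_lie_of_single _ P fun k w ↦ ?_) (map_lie_of_single _ Q fun k w ↦ ?_)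
      (map_lie_of_single _ Z fun k w ↦ ?_)
    · exact ⟨LieModuleEquiv.symm { f with map_lie' := hlie _ _ }⟩
    all_goals simp only [LinearEquiv.coe_coe] at hp he ⊢
    · rw [act_e', hf, hf, act_e, he, sub_add_eq_add_sub]
    · rw [act_h', map_smul, hf, act_h]
      congr 1
      push_cast
      linear_combination -hi
    · rw [act_p', hf, hf, act_p, hp, sub_add_eq_add_sub]
    · rw [act_q', hf, hf, act_q, add_right_comm]
    · rw [act_z', map_smul, hf, act_z]

end
end

section
/- For each ż ∈ ℂ and each λ ∈ ℂ∖{0}, the left R_ż-module R_ż/R_ż(t−λ) is simple; moreover, the images of the elements (t(d/dt))ⁱ, i ∈ ℤ_{≥0}, form a ℂ-basis of R_1/R_1(t−λ), and the images of the elements (t²(d/dt))ⁱ, i ∈ ℤ_{≥0}, form a ℂ-basis of R_0/R_0(t−λ). -/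
set_option synthInstance.maxHeartbeats 1000000
set_option maxHeartbeats 2000000


open scoped TensorProduct

noncomputable section

/-- The element `t` of `R₀`. -/
def tR0 : R0 := ⟨Tm, Algebra.subset_adjoin (by simp)⟩

/-- The element `t²(d/dt)` of `R₀`. -/
def dR0 : R0 := ⟨Tm ^ 2 * Dt, Algebra.subset_adjoin (by simp)⟩

/-- The element `t` of `R₁`. -/
def tR1 : R1 := ⟨Tm, Algebra.subset_adjoin (by simp)⟩

/-- The element `t(d/dt)` of `R₁`. -/
def dR1 : R1 := ⟨Tm * Dt, Algebra.subset_adjoin (by simp)⟩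

/-- If `c = d x - x d` commutes with `x`, then `x ^ (m + 1)` commutes with `d` up to
`(m + 1) x ^ m c`. -/
theorem pow_succ_mul_of_commutator {R : Type*} [Ring R] {x d c : R} (hxc : Commute x c)
    (h : d * x = x * d + c) (m : ℕ) :
    x ^ (m + 1) * d = d * x ^ (m + 1) - ((m + 1 : ℕ) : R) * (x ^ m * c) := by
  have h' : x * d = d * x - c := by rw [h]; abel
  induction m with
  | zero => simp [h']
  | succ m ih =>
    have hc : x * (x ^ m * c) = x ^ (m + 1) * c := by rw [pow_succ']; noncomm_ring
    have hn : x * (((m + 1 : ℕ) : R) * (x ^ m * c)) =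
        ((m + 1 : ℕ) : R) * (x ^ (m + 1) * c) := by
      rw [← mul_assoc, ← (Nat.cast_commute (m + 1) x).eq, mul_assoc, hc]
    rw [pow_succ' x (m + 1), mul_assoc, ih, mul_sub, hn, ← mul_assoc, h', sub_mul,
      ← (hxc.pow_left (m + 1)).eq]
    push_cast
    noncomm_ring

section CyclicModule

variable {R : Type*} [Ring R] [Algebra ℂ R] {M : Type*} [AddCommGroup M] [Module ℂ M]
  [Module R M] [IsScalarTower ℂ R M]

/-- The map `p ↦ p(d) v` from polynomials to a module. -/
def polySmul (d : R) (v : M) : Polynomial ℂ →ₗ[ℂ] M :=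
  (LinearMap.toSpanSingleton R M v).restrictScalars ℂ ∘ₗ (Polynomial.aeval d).toLinearMap

theorem polySmul_apply (d : R) (v : M) (p : Polynomial ℂ) :
    polySmul d v p = Polynomial.aeval d p • v := rfl

theorem sub_algebraMap_pow_smul {t d : R} {v : M} {lam : ℂ} {k : ℕ}
    (hdt : d * t = t * d + t ^ k) (htv : t • v = lam • v) (n : ℕ) :
    (t - algebraMap ℂ R lam) ^ n • d ^ n • v = ((n.factorial : ℂ) * (-lam ^ k) ^ n) • v := by
  have htk : ∀ k : ℕ, t ^ k • v = lam ^ k • v := by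
    intro k
    induction k with
    | zero => simp
    | succ k ih => rw [pow_succ, mul_smul, htv, smul_comm, ih, smul_smul, pow_succ']
  set x := t - algebraMap ℂ R lam with hx
  have hxv : x • v = 0 := by rw [hx, sub_smul, htv, algebraMap_smul, sub_self]
  have hxt : Commute x t := (Commute.refl t).sub_left (Algebra.commutes lam t)
  have hdx : d * x = x * d + t ^ k := by
    rw [hx, mul_sub, sub_mul, hdt, Algebra.commutes lam d]; abel
  induction n with
  | zero => simp
  | succ n ih =>
    have hz : x ^ (n + 1) • d ^ n • v = 0 := by
      rw [pow_succ', mul_smul, ih, smul_comm, hxv, smul_zero]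
    rw [pow_succ' d, mul_smul, ← mul_smul, pow_succ_mul_of_commutator (hxt.pow_right k) hdx,
      sub_smul, mul_smul, hz, smul_zero, (hxt.pow_pow n k).eq, mul_smul, mul_smul, ih,
      smul_comm (t ^ k), htk, Nat.cast_smul_eq_nsmul, ← Nat.cast_smul_eq_nsmul ℂ, smul_smul,
      smul_smul, zero_sub, ← neg_smul]
    congr 1
    rw [Nat.factorial_succ]
    push_cast
    ring

theorem sub_algebraMap_pow_smul_eq_zero {t d : R} {v : M} {lam : ℂ} {k : ℕ}
    (hdt : d * t = t * d + t ^ k) (htv : t • v = lam • v) {m n : ℕ} (hmn : n < m) :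
    (t - algebraMap ℂ R lam) ^ m • d ^ n • v = 0 := by
  obtain ⟨j, rfl⟩ := Nat.exists_eq_add_of_lt hmn
  have hxv : (t - algebraMap ℂ R lam) • v = 0 := by
    rw [sub_smul, htv, algebraMap_smul, sub_self]
  rw [show n + j + 1 = j + 1 + n by ring, pow_add, mul_smul, sub_algebraMap_pow_smul hdt htv,
    smul_comm, pow_succ, mul_smul (_ ^ j), hxv, smul_zero, smul_zero]

theorem sub_algebraMap_pow_smul_polySmul {t d : R} {v : M} {lam : ℂ} {k : ℕ}
    (hdt : d * t = t * d + t ^ k) (htv : t • v = lam • v) (p : Polynomial ℂ) :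
    (t - algebraMap ℂ R lam) ^ p.natDegree • polySmul d v p =
      (p.leadingCoeff * ((p.natDegree.factorial : ℂ) * (-lam ^ k) ^ p.natDegree)) • v := by
  rw [polySmul_apply, Polynomial.aeval_eq_sum_range, Finset.sum_smul, Finset.smul_sum,
    Finset.sum_range_succ, Finset.sum_eq_zero, zero_add, smul_assoc, smul_comm,
    sub_algebraMap_pow_smul hdt htv, smul_smul, Polynomial.leadingCoeff]
  intro i hi
  rw [smul_assoc, smul_comm, sub_algebraMap_pow_smul_eq_zero hdt htv (Finset.mem_range.1 hi),
    smul_zero]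

theorem exists_smul_polySmul_eq {t d : R} {v : M} {lam : ℂ} {k : ℕ}
    (hdt : d * t = t * d + t ^ k) (htv : t • v = lam • v) (hlam : lam ≠ 0)
    {p : Polynomial ℂ} (hp : p ≠ 0) : ∃ r : R, r • polySmul d v p = v := by
  have hc : p.leadingCoeff * ((p.natDegree.factorial : ℂ) * (-lam ^ k) ^ p.natDegree) ≠ 0 :=
    mul_ne_zero (Polynomial.leadingCoeff_ne_zero.2 hp) (mul_ne_zero
      (Nat.cast_ne_zero.2 (Nat.factorial_ne_zero _))
      (pow_ne_zero _ (neg_ne_zero.2 (pow_ne_zero _ hlam))))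
  refine ⟨(p.leadingCoeff * ((p.natDegree.factorial : ℂ) * (-lam ^ k) ^ p.natDegree))⁻¹ •
    (t - algebraMap ℂ R lam) ^ p.natDegree, ?_⟩
  rw [smul_assoc, sub_algebraMap_pow_smul_polySmul hdt htv, smul_smul, inv_mul_cancel₀ hc,
    one_smul]

theorem linearIndependent_pow_smul {t d : R} {v : M} {lam : ℂ} {k : ℕ}
    (hdt : d * t = t * d + t ^ k) (htv : t • v = lam • v) (hlam : lam ≠ 0) (hv : v ≠ 0) :
    LinearIndependent ℂ (fun n : ℕ => d ^ n • v) := by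
  have hker : LinearMap.ker (polySmul d v) = ⊥ := by
    refine LinearMap.ker_eq_bot'.2 fun p hp => by_contra fun hp0 => hv ?_
    obtain ⟨r, hr⟩ := exists_smul_polySmul_eq hdt htv hlam hp0
    rw [← hr, hp, smul_zero]
  have hbasis : (fun n : ℕ => d ^ n • v) = polySmul d v ∘ Polynomial.basisMonomials ℂ := by
    funext n
    simp [polySmul_apply, Polynomial.aeval_monomial]
  rw [hbasis]
  exact (Polynomial.basisMonomials ℂ).linearIndependent.map' _ hker

theorem span_pow_smul_eq_top {t d : R} {v : M} {lam : ℂ} {k : ℕ}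
    (hdt : d * t = t * d + t ^ k) (htv : t • v = lam • v)
    (hgen : Algebra.adjoin ℂ {t, d} = ⊤) (hcyc : ∀ m : M, ∃ r : R, r • v = m) :
    Submodule.span ℂ (Set.range fun n : ℕ => d ^ n • v) = ⊤ := by
  set W := Submodule.span ℂ (Set.range fun n : ℕ => d ^ n • v) with hW
  have hpow (n : ℕ) : d ^ n • v ∈ W := Submodule.subset_span ⟨n, rfl⟩
  have stable (r : R) (h : ∀ n : ℕ, r • d ^ n • v ∈ W) (m : M) (hm : m ∈ W) : r • m ∈ W := by
    induction hm using Submodule.span_induction with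
    | mem x hx => obtain ⟨n, rfl⟩ := hx; exact h n
    | zero => rw [smul_zero]; exact W.zero_mem
    | add x y _ _ hx hy => rw [smul_add]; exact W.add_mem hx hy
    | smul c x _ hx => rw [smul_comm]; exact W.smul_mem c hx
  have hd : ∀ m ∈ W, d • m ∈ W :=
    stable d fun n => by rw [← mul_smul, ← pow_succ']; exact hpow _
  have htpow (n : ℕ) : ∀ j : ℕ, t ^ j • d ^ n • v ∈ W := by
    induction n with
    | zero =>
      intro j
      induction j with
      | zero => simpa using hpow 0
      | succ j ih =>
        rw [pow_zero, one_smul] at ih ⊢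
        rw [pow_succ, mul_smul, htv, smul_comm]
        exact W.smul_mem _ ih
    | succ n ih =>
      rintro (_ | j)
      · simpa using hpow (n + 1)
      · rw [pow_succ' d, mul_smul, ← mul_smul,
          pow_succ_mul_of_commutator ((Commute.refl t).pow_right k) hdt, sub_smul, mul_smul,
          mul_smul, ← pow_add, Nat.cast_smul_eq_nsmul]
        exact W.sub_mem (hd _ (ih _)) (W.smul_of_tower_mem _ (ih _))
  have ht : ∀ m ∈ W, t • m ∈ W := stable t fun n => by simpa using htpow n 1
  have hall (r : R) : ∀ m ∈ W, r • m ∈ W := by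
    have hr : r ∈ Algebra.adjoin ℂ {t, d} := hgen ▸ Algebra.mem_top
    induction hr using Algebra.adjoin_induction with
    | mem x hx =>
      rcases hx with rfl | rfl
      · exact ht
      · exact hd
    | algebraMap c => intro m hm; rw [algebraMap_smul]; exact W.smul_mem c hm
    | add x y _ _ hx hy => intro m hm; rw [add_smul]; exact W.add_mem (hx m hm) (hy m hm)
    | mul x y _ _ hx hy => intro m hm; rw [mul_smul]; exact hx _ (hy m hm)
  refine Submodule.eq_top_iff'.2 fun m => ?_
  obtain ⟨r, rfl⟩ := hcyc m
  exact hall r v (by simpa using hpow 0)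

theorem isSimpleModule_of_cyclic {t d : R} {v : M} {lam : ℂ} {k : ℕ}
    (hdt : d * t = t * d + t ^ k) (htv : t • v = lam • v) (hlam : lam ≠ 0) (hv : v ≠ 0)
    (hgen : Algebra.adjoin ℂ {t, d} = ⊤) (hcyc : ∀ m : M, ∃ r : R, r • v = m) :
    IsSimpleModule R M := by
  have hspan : LinearMap.range (polySmul d v) = ⊤ := by
    rw [eq_top_iff, ← span_pow_smul_eq_top hdt htv hgen hcyc, Submodule.span_le]
    rintro _ ⟨n, rfl⟩
    exact ⟨Polynomial.X ^ n, by simp [polySmul_apply]⟩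
  refine isSimpleModule_iff_toSpanSingleton_surjective.2 ⟨⟨v, 0, hv⟩, fun m hm y => ?_⟩
  obtain ⟨p, rfl⟩ := LinearMap.range_eq_top.1 hspan m
  obtain ⟨r, hr⟩ := exists_smul_polySmul_eq hdt htv hlam
    (show p ≠ 0 by rintro rfl; exact hm (map_zero _))
  obtain ⟨s, rfl⟩ := hcyc y
  exact ⟨s * r, by rw [LinearMap.toSpanSingleton_apply, mul_smul, hr]⟩

end CyclicModule

/-- The commutator with multiplication by `t`. -/
def adT : Module.End ℂ (Module.End ℂ (Polynomial ℂ)) :=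
  LinearMap.mulLeft ℂ Tm - LinearMap.mulRight ℂ Tm

theorem adT_apply (a : Module.End ℂ (Polynomial ℂ)) : adT a = Tm * a - a * Tm := rfl

theorem adT_mul (a b : Module.End ℂ (Polynomial ℂ)) :
    adT (a * b) = adT a * b + a * adT b := by
  simp only [adT_apply, sub_mul, mul_sub, mul_assoc, sub_add_sub_cancel]

theorem adT_pow_eq_zero_mono {a : Module.End ℂ (Polynomial ℂ)} {m n : ℕ} (hmn : m ≤ n)
    (h : (adT ^ m) a = 0) : (adT ^ n) a = 0 := by
  obtain ⟨j, rfl⟩ := Nat.exists_eq_add_of_le' hmn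
  rw [pow_add, Module.End.mul_apply, h, map_zero]

theorem adT_pow_mul_eq_zero {a b : Module.End ℂ (Polynomial ℂ)} {m n : ℕ}
    (ha : (adT ^ m) a = 0) (hb : (adT ^ n) b = 0) : (adT ^ (m + n)) (a * b) = 0 := by
  induction m generalizing a b n with
  | zero => rw [show a = 0 from ha, zero_mul, map_zero]
  | succ m ihm =>
    induction n generalizing b with
    | zero => rw [show b = 0 from hb, mul_zero, map_zero]
    | succ n ihn =>
      rw [← add_assoc, pow_succ, Module.End.mul_apply, adT_mul, map_add,
        ihn (by rwa [pow_succ] at hb), add_zero, add_right_comm]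
      exact ihm (by rwa [pow_succ] at ha) hb

theorem Dt_mul_Tm : Dt * Tm = Tm * Dt + 1 := by
  refine LinearMap.ext fun p => ?_
  simp [Dt, Tm, Module.End.mul_apply, Polynomial.derivative_mul, add_comm]

theorem exists_adT_pow_eq_zero {a : Module.End ℂ (Polynomial ℂ)} (ha : a ∈ WeylA) :
    ∃ n : ℕ, (adT ^ n) a = 0 := by
  induction ha using Algebra.adjoin_induction with
  | mem x hx =>
    have hD : adT Dt = -1 := by
      rw [adT_apply, Dt_mul_Tm, sub_add_cancel_left]
    refine ⟨2, ?_⟩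
    rcases hx with rfl | rfl
    · rw [pow_two, Module.End.mul_apply, hD, map_neg, adT_apply, mul_one, one_mul, sub_self,
        neg_zero]
    · simp [pow_two, adT_apply]
  | algebraMap c =>
    exact ⟨1, by rw [pow_one, adT_apply, Algebra.commutes, sub_self]⟩
  | add x y _ _ hx hy =>
    obtain ⟨m, hm⟩ := hx
    obtain ⟨n, hn⟩ := hy
    refine ⟨m + n, ?_⟩
    rw [map_add, adT_pow_eq_zero_mono (Nat.le_add_right m n) hm,
      adT_pow_eq_zero_mono (Nat.le_add_left n m) hn, add_zero]
  | mul x y _ _ hx hy =>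
    obtain ⟨m, hm⟩ := hx
    obtain ⟨n, hn⟩ := hy
    exact ⟨m + n, adT_pow_mul_eq_zero hm hn⟩

/-- An operator commuting with `t` is multiplication by its value at `1`. -/
theorem apply_eq_of_adT_eq_zero {a : Module.End ℂ (Polynomial ℂ)} (ha : adT a = 0)
    (p : Polynomial ℂ) : a p = p * a 1 := by
  have hX (q : Polynomial ℂ) : a (Polynomial.X * q) = Polynomial.X * a q :=
    by
    have h := LinearMap.congr_fun ha q
    rw [adT_apply, LinearMap.sub_apply, LinearMap.zero_apply, sub_eq_zero] at h
    exact h.symm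
  induction p using Polynomial.induction_on' with
  | add p q hp hq => rw [map_add, hp, hq, add_mul]
  | monomial n c =>
    rw [← Polynomial.C_mul_X_pow_eq_monomial, ← Polynomial.smul_eq_C_mul, map_smul,
      smul_mul_assoc]
    congr 1
    induction n with
    | zero => simp
    | succ n ih => rw [pow_succ', hX, ih, mul_assoc]

theorem mul_Tm_sub_ne_one {a : Module.End ℂ (Polynomial ℂ)} (ha : a ∈ WeylA) (lam : ℂ) :
    a * (Tm - algebraMap ℂ _ lam) ≠ 1 := by
  intro h
  set x := Tm - algebraMap ℂ (Module.End ℂ (Polynomial ℂ)) lam with hx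
  have hTx : adT x = 0 := by
    rw [hx, map_sub, adT_apply, adT_apply, Algebra.commutes, sub_self, sub_self, sub_self]
  have hx1 : x 1 = Polynomial.X - Polynomial.C lam := by
    simp [hx, Tm, Algebra.algebraMap_eq_smul_one, Polynomial.smul_eq_C_mul]
  have hsucc (m : ℕ) : (adT ^ (m + 1)) a * x = 0 := by
    induction m with
    | zero =>
      have h1 := adT_mul a x
      rw [h, hTx, mul_zero, add_zero, adT_apply, mul_one, one_mul, sub_self] at h1
      rw [zero_add, pow_one, ← h1]
    | succ m ih =>
      have h1 := adT_mul ((adT ^ (m + 1)) a) x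
      rw [ih, hTx, mul_zero, add_zero, map_zero] at h1
      rw [pow_succ' adT (m + 1), Module.End.mul_apply, ← h1]
  have hdesc (m : ℕ) : (adT ^ (m + 1)) a ≠ 0 := by
    induction m with
    | zero =>
      intro h0
      have h1 : a (x 1) = 1 := LinearMap.congr_fun h 1
      rw [apply_eq_of_adT_eq_zero (by simpa using h0), hx1] at h1
      exact Polynomial.not_isUnit_X_sub_C lam (IsUnit.of_mul_eq_one _ h1)
    | succ m ih =>
      intro h0
      have hc : adT ((adT ^ (m + 1)) a) = 0 := by
        rw [pow_succ' adT (m + 1), Module.End.mul_apply] at h0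
        exact h0
      have h1 : ((adT ^ (m + 1)) a) (x 1) = 0 := LinearMap.congr_fun (hsucc m) 1
      rw [apply_eq_of_adT_eq_zero hc, hx1] at h1
      have h2 := (mul_eq_zero.1 h1).resolve_left (Polynomial.X_sub_C_ne_zero lam)
      exact ih (LinearMap.ext fun p => by
        rw [apply_eq_of_adT_eq_zero hc, h2, mul_zero, LinearMap.zero_apply])
  obtain ⟨n, hn⟩ := exists_adT_pow_eq_zero ha
  exact hdesc n (adT_pow_eq_zero_mono n.le_succ hn)

theorem Tm_pow_mul_Dt_mul_Tm (k : ℕ) :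
    Tm ^ k * Dt * Tm = Tm * (Tm ^ k * Dt) + Tm ^ k := by
  rw [mul_assoc, Dt_mul_Tm, mul_add, mul_one, ← mul_assoc, ← mul_assoc, ← pow_succ, pow_succ']

theorem isSimpleModule_and_basis_of_subalgebra {S : Subalgebra ℂ (Module.End ℂ (Polynomial ℂ))}
    {k : ℕ} (hS : S = Algebra.adjoin ℂ {Tm, Tm ^ k * Dt}) {t d : S}
    (ht : (t : Module.End ℂ (Polynomial ℂ)) = Tm)
    (hd : (d : Module.End ℂ (Polynomial ℂ)) = Tm ^ k * Dt) {lam : ℂ} (hlam : lam ≠ 0)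
    {M : Type*} [AddCommGroup M] [Module ℂ M] [Module S M] [IsScalarTower ℂ S M]
    (f : S →ₗ[S] M) (hf : Function.Surjective f)
    (hker : ∀ x : S, f x = 0 ↔ x ∈ Ideal.span {t - algebraMap ℂ S lam}) :
    IsSimpleModule S M ∧ LinearIndependent ℂ (fun n : ℕ => f (d ^ n)) ∧
      Submodule.span ℂ (Set.range (fun n : ℕ => f (d ^ n))) = ⊤ := by
  have hfs (r : S) : f r = r • f 1 := by rw [← map_smul, smul_eq_mul, mul_one]
  have hdt : d * t = t * d + t ^ k := Subtype.ext <| by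
    simp only [MulMemClass.coe_mul, AddMemClass.coe_add, SubmonoidClass.coe_pow, ht, hd]
    exact Tm_pow_mul_Dt_mul_Tm k
  have htv : t • f 1 = lam • f 1 := by
    have h := (hker _).2 (Ideal.mem_span_singleton_self (t - algebraMap ℂ S lam))
    rw [hfs] at h
    have h' := sub_smul t (algebraMap ℂ S lam) (f 1)
    rw [algebraMap_smul] at h'
    exact sub_eq_zero.1 (h'.symm.trans h)
  have hSW : S ≤ WeylA := by
    have hT : Tm ∈ WeylA := Algebra.subset_adjoin (by simp)
    have hD : Dt ∈ WeylA := Algebra.subset_adjoin (by simp)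
    rw [hS, Algebra.adjoin_le_iff]
    rintro _ (rfl | rfl)
    · exact hT
    · exact mul_mem (pow_mem hT k) hD
  have hv : f 1 ≠ 0 := by
    intro h
    obtain ⟨a, ha⟩ := Ideal.mem_span_singleton'.1 ((hker 1).1 h)
    refine mul_Tm_sub_ne_one (hSW a.2) lam ?_
    rw [← ht]
    exact congrArg Subtype.val ha
  have hgen : Algebra.adjoin ℂ {t, d} = ⊤ := by
    refine Subalgebra.map_injective (f := S.val) Subtype.val_injective ?_
    rw [AlgHom.map_adjoin, Set.image_pair, Algebra.map_top, Subalgebra.range_val,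
      Subalgebra.val_apply, Subalgebra.val_apply, ht, hd, ← hS]
  have hcyc (m : M) : ∃ r : S, r • f 1 = m := by
    obtain ⟨r, rfl⟩ := hf m
    exact ⟨r, (hfs r).symm⟩
  simp only [hfs (d ^ _)]
  have hsimple := isSimpleModule_of_cyclic (R := S) (M := M) hdt htv hlam hv hgen hcyc
  have hindep := linearIndependent_pow_smul (R := S) (M := M) hdt htv hlam hv
  have hspan := span_pow_smul_eq_top (R := S) (M := M) hdt htv hgen hcyc
  exact ⟨hsimple, hindep, hspan⟩

theorem Rz_eq_adjoin (zc : ℂ) :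
    Rz zc = Algebra.adjoin ℂ {Tm, Tm ^ (if zc = 0 then 2 else 1) * Dt} := by
  unfold Rz; split_ifs <;> simp [R0, R1]

theorem coe_dR (zc : ℂ) :
    (dR zc : Module.End ℂ (Polynomial ℂ)) = Tm ^ (if zc = 0 then 2 else 1) * Dt := by
  unfold dR; split_ifs <;> simp

/-- For each `zc ∈ ℂ` and each `lam ∈ ℂ \ {0}`, the left
`R_zc`-module `R_zc/R_zc(t - lam)` is simple; moreover the images of the elements
`(t(d/dt))ⁿ`, `n ∈ ℕ`, form a `ℂ`-basis of `R₁/R₁(t - lam)`, and the images of the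
elements `(t²(d/dt))ⁿ`, `n ∈ ℕ`, form a `ℂ`-basis of `R₀/R₀(t - lam)`.  (Quotients are
expressed below as surjective linear maps whose kernel is the respective left ideal.) -/
theorem Rz_mod_t_sub_lam (zc : ℂ) (lam : ℂ) (hlam : lam ≠ 0) :
    (∀ (M : Type) (_ : AddCommGroup M) (_ : Module (Rz zc) M)
        (f : Rz zc →ₗ[Rz zc] M), Function.Surjective f →
      (∀ x : Rz zc, f x = 0 ↔ x ∈ Ideal.span {tR zc - algebraMap ℂ (Rz zc) lam}) →
      IsSimpleModule (Rz zc) M) ∧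
    (∀ (M : Type) (_ : AddCommGroup M) (_ : Module ℂ M) (_ : Module R1 M)
        (_ : IsScalarTower ℂ R1 M) (f : R1 →ₗ[R1] M), Function.Surjective f →
      (∀ x : R1, f x = 0 ↔ x ∈ Ideal.span {tR1 - algebraMap ℂ R1 lam}) →
      (LinearIndependent ℂ (fun n : ℕ => f (dR1 ^ n)) ∧
        Submodule.span ℂ (Set.range (fun n : ℕ => f (dR1 ^ n))) = ⊤)) ∧
    (∀ (M : Type) (_ : AddCommGroup M) (_ : Module ℂ M) (_ : Module R0 M)
        (_ : IsScalarTower ℂ R0 M) (f : R0 →ₗ[R0] M), Function.Surjective f →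
      (∀ x : R0, f x = 0 ↔ x ∈ Ideal.span {tR0 - algebraMap ℂ R0 lam}) →
      (LinearIndependent ℂ (fun n : ℕ => f (dR0 ^ n)) ∧
        Submodule.span ℂ (Set.range (fun n : ℕ => f (dR0 ^ n))) = ⊤)) := by
  refine ⟨?_, ?_, ?_⟩
  · intro M _ _ f hf hker
    let _ : Module ℂ M := Module.compHom M (algebraMap ℂ (Rz zc))
    have _ : IsScalarTower ℂ (Rz zc) M := ⟨fun c r m => by
      rw [Algebra.smul_def, mul_smul]; rfl⟩
    exact (isSimpleModule_and_basis_of_subalgebra (Rz_eq_adjoin zc) (t := tR zc) rfl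
      (coe_dR zc) hlam f hf hker).1
  · intro M _ _ _ _ f hf hker
    exact (isSimpleModule_and_basis_of_subalgebra (S := R1) (k := 1) (by rw [pow_one]; rfl)
      (t := tR1) (d := dR1) rfl (by rw [pow_one]; rfl) hlam f hf hker).2
  · intro M _ _ _ _ f hf hker
    exact (isSimpleModule_and_basis_of_subalgebra (S := R0) (k := 2) rfl
      (t := tR0) (d := dR0) rfl rfl hlam f hf hker).2

end
end
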